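/- arXiv:1202.0249 — 7 statements merged into one kernel-verified Lean document; each statement's English description precedes it below -/
import Mathlib

section
/- Composite trapezoidal rule: Let a < b be real numbers, let n ≥ 1 be a natural number, and let f be twice continuously differentiable on [a,b]. For 0 ≤ i ≤ n set x_i = a + (b−a)i/n. Then |∫_a^b f(x) dx − ((b−a)/(2n))·(f(a) + 2∑_{i=1}^{n−1} f(x_i) + f(b))| ≤ (b−a)^3 · ‖f''‖_∞ / (12 n^2). -/
/-- Mathlib's trapezoidal sum, with the interior nodes indexed by `1, …, n - 1`. -/
theorem trapezoidal_integral_eq_sum_Icc (f : ℝ → ℝ) (n : ℕ) (a b : ℝ) :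
    trapezoidal_integral f n a b =
      (b - a) / (2 * n) *
        (f a + 2 * ∑ i ∈ Finset.Icc 1 (n - 1), f (a + (b - a) * (i : ℝ) / n) + f b) := by
  have hsum : ∑ i ∈ Finset.Icc 1 (n - 1), f (a + (b - a) * (i : ℝ) / n) =
      ∑ k ∈ Finset.range (n - 1), f (a + (k + 1) * (b - a) / n) := by
    rw [← Finset.Ico_add_one_right_eq_Icc, Finset.sum_Ico_eq_sum_range, Nat.add_sub_cancel]
    refine Finset.sum_congr rfl fun k _ => ?_
    rw [mul_comm (b - a), Nat.cast_add, Nat.cast_one, add_comm (1 : ℝ)]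
  rw [trapezoidal_integral, hsum]
  ring

/-- Composite trapezoidal rule. -/
theorem composite_trapezoidal_rule (a b : ℝ) (hab : a < b) (n : ℕ) (hn : 1 ≤ n)
    (f f' f'' : ℝ → ℝ)
    (hf : ∀ x ∈ Set.Icc a b, HasDerivWithinAt f (f' x) (Set.Icc a b) x)
    (hf' : ∀ x ∈ Set.Icc a b, HasDerivWithinAt f' (f'' x) (Set.Icc a b) x)
    (hf'' : ContinuousOn f'' (Set.Icc a b)) :
    |(∫ x in a..b, f x) -
        (b - a) / (2 * n) *
          (f a + 2 * ∑ i ∈ Finset.Icc 1 (n - 1), f (a + (b - a) * (i : ℝ) / n) + f b)| ≤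
      (b - a) ^ 3 * sSup ((fun x => |f'' x|) '' Set.Icc a b) / (12 * (n : ℝ) ^ 2) := by
  have hunique := uniqueDiffOn_Icc hab
  have hderiv : Set.EqOn (derivWithin f (Set.Icc a b)) f' (Set.Icc a b) :=
    fun x hx => (hf x hx).derivWithin (hunique x hx)
  have hderiv₂ : ∀ x ∈ Set.Icc a b,
      HasDerivWithinAt (derivWithin f (Set.Icc a b)) (f'' x) (Set.Icc a b) x :=
    fun x hx => (hf' x hx).congr hderiv (hderiv hx)
  have hbdd : BddAbove ((fun x => |f'' x|) '' Set.Icc a b) :=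
    isCompact_Icc.bddAbove_image hf''.abs
  have hbound : ∀ x, |iteratedDerivWithin 2 f (Set.Icc a b) x| ≤
      sSup ((fun x => |f'' x|) '' Set.Icc a b) := by
    intro x
    rw [iteratedDerivWithin_succ, iteratedDerivWithin_one]
    by_cases hx : x ∈ Set.Icc a b
    · rw [(hderiv₂ x hx).derivWithin (hunique x hx)]
      exact le_csSup hbdd (Set.mem_image_of_mem _ hx)
    · rw [derivWithin_zero_of_notMem_closure (by rwa [closure_Icc]), abs_zero]
      exact Real.sSup_nonneg (by rintro _ ⟨y, -, rfl⟩; exact abs_nonneg _)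
  rw [← Set.uIcc_of_le hab.le] at hf hderiv₂ hbound
  have herror := trapezoidal_error_le (fun x hx => (hf x hx).differentiableWithinAt)
    (fun x hx => (hderiv₂ x hx).differentiableWithinAt) hbound hn
  rwa [trapezoidal_error, trapezoidal_integral_eq_sum_Icc, abs_sub_comm, Set.uIcc_of_le hab.le,
    abs_of_pos (sub_pos.mpr hab)] at herror
end

section
/- Simpson's rule: Let a < b be real numbers and let f be four times continuously differentiable on [a,b]. Then |∫_a^b f(x) dx − ((b−a)/6)·(f(a) + 4 f((a+b)/2) + f(b))| ≤ (b−a)^5 · ‖f⁽⁴⁾‖_∞ / 2880. -/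
/-- A function on `[0, h]` that vanishes at `0` and whose derivative is bounded by `C * t ^ n`
is itself bounded by `C / (n + 1) * t ^ (n + 1)`. -/
theorem abs_le_of_abs_deriv_le_mul_pow {h C : ℝ} (n : ℕ) {g g' : ℝ → ℝ}
    (hg : ∀ t ∈ Set.Icc 0 h, HasDerivWithinAt g (g' t) (Set.Icc 0 h) t) (hg0 : g 0 = 0)
    (hg' : ∀ t ∈ Set.Icc 0 h, |g' t| ≤ C * t ^ n) :
    ∀ t ∈ Set.Icc 0 h, |g t| ≤ C / (n + 1) * t ^ (n + 1) := by
  intro t ht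
  refine image_norm_le_of_norm_deriv_right_le_deriv_boundary (a := 0) (b := h) (f' := g')
    (B := fun t => C / (n + 1) * t ^ (n + 1)) (B' := fun t => C * t ^ n)
    (fun x hx => (hg x hx).continuousWithinAt) (fun x hx => ?_) (by simp [hg0]) (fun x => ?_)
    (fun x hx => hg' x (Set.Ico_subset_Icc_self hx)) ht
  · exact (hg x (Set.Ico_subset_Icc_self hx)).mono_of_mem_nhdsWithin
      (Icc_mem_nhdsGE_of_mem hx)
  · refine ((hasDerivAt_pow (n + 1) x).const_mul (C / (n + 1))).congr_deriv ?_
    have : (n : ℝ) + 1 ≠ 0 := by positivity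
    push_cast
    field_simp

/-- Simpson's rule on the symmetric interval `[c - h, c + h]`, for the primitive `F` of `f`. -/
theorem abs_sub_simpson_le_of_hasDerivWithinAt {c h M : ℝ} (hh : 0 ≤ h)
    {F f f1 f2 f3 f4 : ℝ → ℝ}
    (hF : ∀ x ∈ Set.Icc (c - h) (c + h), HasDerivWithinAt F (f x) (Set.Icc (c - h) (c + h)) x)
    (hf : ∀ x ∈ Set.Icc (c - h) (c + h), HasDerivWithinAt f (f1 x) (Set.Icc (c - h) (c + h)) x)
    (hf1 : ∀ x ∈ Set.Icc (c - h) (c + h), HasDerivWithinAt f1 (f2 x) (Set.Icc (c - h) (c + h)) x)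
    (hf2 : ∀ x ∈ Set.Icc (c - h) (c + h), HasDerivWithinAt f2 (f3 x) (Set.Icc (c - h) (c + h)) x)
    (hf3 : ∀ x ∈ Set.Icc (c - h) (c + h), HasDerivWithinAt f3 (f4 x) (Set.Icc (c - h) (c + h)) x)
    (hM : ∀ x ∈ Set.Icc (c - h) (c + h), |f4 x| ≤ M) :
    |F (c + h) - F (c - h) - h / 3 * (f (c - h) + 4 * f c + f (c + h))| ≤ M / 90 * h ^ 5 := by
  have mem_add : ∀ t ∈ Set.Icc 0 h, c + t ∈ Set.Icc (c - h) (c + h) := fun t ht =>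
    ⟨by linarith [ht.1], by linarith [ht.2]⟩
  have mem_sub : ∀ t ∈ Set.Icc 0 h, c - t ∈ Set.Icc (c - h) (c + h) := fun t ht =>
    ⟨by linarith [ht.2], by linarith [ht.1]⟩
  have deriv_add : ∀ {g g' : ℝ → ℝ},
      (∀ x ∈ Set.Icc (c - h) (c + h), HasDerivWithinAt g (g' x) (Set.Icc (c - h) (c + h)) x) →
      ∀ t ∈ Set.Icc 0 h, HasDerivWithinAt (fun t => g (c + t)) (g' (c + t)) (Set.Icc 0 h) t := by
    intro g g' hg t ht
    exact ((hg _ (mem_add t ht)).comp t ((hasDerivWithinAt_id t _).const_add c)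
      mem_add).congr_deriv (mul_one _)
  have deriv_sub : ∀ {g g' : ℝ → ℝ},
      (∀ x ∈ Set.Icc (c - h) (c + h), HasDerivWithinAt g (g' x) (Set.Icc (c - h) (c + h)) x) →
      ∀ t ∈ Set.Icc 0 h, HasDerivWithinAt (fun t => g (c - t)) (-g' (c - t)) (Set.Icc 0 h) t := by
    intro g g' hg t ht
    exact ((hg _ (mem_sub t ht)).comp t ((hasDerivWithinAt_id t _).const_sub c)
      mem_sub).congr_deriv (mul_neg_one _)
  have error_deriv3_le : ∀ t ∈ Set.Icc 0 h,
      |-(t / 3) * (f3 (c + t) - f3 (c - t))| ≤ 2 / 3 * M * t ^ 2 := by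
    intro t ht
    have key := (convex_Icc (c - h) (c + h)).norm_image_sub_le_of_norm_hasDerivWithin_le
      hf3 hM (mem_sub t ht) (mem_add t ht)
    have ht0 := ht.1
    rw [Real.norm_eq_abs, Real.norm_eq_abs, show c + t - (c - t) = 2 * t by ring,
      abs_of_nonneg (by positivity : 0 ≤ 2 * t)] at key
    rw [abs_mul, abs_neg, abs_of_nonneg (by positivity : 0 ≤ t / 3)]
    calc t / 3 * |f3 (c + t) - f3 (c - t)| ≤ t / 3 * (M * (2 * t)) := by gcongr
      _ = 2 / 3 * M * t ^ 2 := by ring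
  have error_deriv2_le := abs_le_of_abs_deriv_le_mul_pow 2
    (g := fun t => 1 / 3 * (f1 (c + t) - f1 (c - t)) - t / 3 * (f2 (c + t) + f2 (c - t)))
    (fun t ht => ((((deriv_add hf1 t ht).sub (deriv_sub hf1 t ht)).const_mul (1 / 3)).sub
      (((hasDerivWithinAt_id t _).div_const 3).mul
        ((deriv_add hf2 t ht).add (deriv_sub hf2 t ht)))).congr_deriv
          (by simp only [id, Pi.add_apply]; ring))
    (by simp) error_deriv3_le
  have error_deriv1_le := abs_le_of_abs_deriv_le_mul_pow 3
    (g := fun t => 2 / 3 * (f (c + t) + f (c - t)) - 4 / 3 * f c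
      - t / 3 * (f1 (c + t) - f1 (c - t)))
    (fun t ht => (((((deriv_add hf t ht).add (deriv_sub hf t ht)).const_mul (2 / 3)).sub_const
      (4 / 3 * f c)).sub (((hasDerivWithinAt_id t _).div_const 3).mul
        ((deriv_add hf1 t ht).sub (deriv_sub hf1 t ht)))).congr_deriv
          (by simp only [id, Pi.sub_apply]; ring))
    (by simp; ring) error_deriv2_le
  have error_le := abs_le_of_abs_deriv_le_mul_pow 4
    (g := fun t => F (c + t) - F (c - t) - t / 3 * (f (c - t) + 4 * f c + f (c + t)))
    (fun t ht => (((deriv_add hF t ht).sub (deriv_sub hF t ht)).sub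
      (((hasDerivWithinAt_id t _).div_const 3).mul
        (((deriv_sub hf t ht).add_const (4 * f c)).add (deriv_add hf t ht)))).congr_deriv
          (by simp only [id, Pi.add_apply]; ring))
    (by simp) error_deriv1_le h ⟨hh, le_rfl⟩
  refine error_le.trans_eq ?_
  push_cast
  ring

/-- Simpson's rule. -/
theorem simpsons_rule (a b : ℝ) (hab : a < b) (f f1 f2 f3 f4 : ℝ → ℝ)
    (hf : ∀ x ∈ Set.Icc a b, HasDerivWithinAt f (f1 x) (Set.Icc a b) x)
    (hf1 : ∀ x ∈ Set.Icc a b, HasDerivWithinAt f1 (f2 x) (Set.Icc a b) x)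
    (hf2 : ∀ x ∈ Set.Icc a b, HasDerivWithinAt f2 (f3 x) (Set.Icc a b) x)
    (hf3 : ∀ x ∈ Set.Icc a b, HasDerivWithinAt f3 (f4 x) (Set.Icc a b) x)
    (hf4 : ContinuousOn f4 (Set.Icc a b)) :
    |(∫ x in a..b, f x) - (b - a) / 6 * (f a + 4 * f ((a + b) / 2) + f b)| ≤
      (b - a) ^ 5 * sSup ((fun x => |f4 x|) '' Set.Icc a b) / 2880 := by
  have hcont : ContinuousOn f (Set.Icc a b) := fun x hx => (hf x hx).continuousWithinAt
  have hF : ∀ x ∈ Set.Icc a b,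
      HasDerivWithinAt (fun u => ∫ y in a..u, f y) (f x) (Set.Icc a b) x := by
    intro x hx
    have : Fact (x ∈ Set.Icc a b) := ⟨hx⟩
    exact intervalIntegral.integral_hasDerivWithinAt_right
      ((hcont.mono (Set.Icc_subset_Icc_right hx.2)).intervalIntegrable_of_Icc hx.1)
      (hcont.stronglyMeasurableAtFilter_nhdsWithin measurableSet_Icc x) (hcont x hx)
  have hM : ∀ x ∈ Set.Icc a b, |f4 x| ≤ sSup ((fun x => |f4 x|) '' Set.Icc a b) := fun x hx =>
    le_csSup (isCompact_Icc.image_of_continuousOn hf4.abs).bddAbove (Set.mem_image_of_mem _ hx)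
  have ha : (a + b) / 2 - (b - a) / 2 = a := by ring
  have hb : (a + b) / 2 + (b - a) / 2 = b := by ring
  have key := abs_sub_simpson_le_of_hasDerivWithinAt (c := (a + b) / 2) (h := (b - a) / 2)
    (M := sSup ((fun x => |f4 x|) '' Set.Icc a b)) (F := fun u => ∫ y in a..u, f y)
    (f := f) (f1 := f1) (f2 := f2) (f3 := f3) (f4 := f4) (by linarith)
  rw [ha, hb] at key
  convert key hF hf hf1 hf2 hf3 hM using 1
  · rw [intervalIntegral.integral_same]
    congr 1
    ring
  · ring
end

section
/- Let a < b be real numbers and fix a natural number k ≥ 1. Suppose p is a monic real polynomial of degree k that minimizes I(q) = ∫_a^b |q(x)| dx over all monic real polynomials q of degree k (i.e., ∫_a^b |p(x)| dx ≤ ∫_a^b |q(x)| dx for every monic real polynomial q of degree k). Then p has k real roots, counting multiplicities, and every root of p lies in the interval [a,b]; equivalently, p splits over ℝ and the multiset of its real roots has cardinality k with each root in [a,b]. -/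
open Polynomial in
/-- If a factor of a monic polynomial `p` can be replaced by a monic polynomial of the same degree
that is strictly smaller in absolute value on `[a, b]`, then `p` does not minimise the `L¹` norm. -/
theorem exists_monic_integral_abs_lt_of_dvd {a b : ℝ} (hab : a < b) {p f h : ℝ[X]}
    (hp : p.Monic) (hf : f.Monic) (hh : h.Monic) (hfp : f ∣ p)
    (hdeg : h.natDegree = f.natDegree)
    (hlt : ∀ x ∈ Set.Icc a b, |h.eval x| < |f.eval x|) :
    ∃ q : ℝ[X], q.Monic ∧ q.natDegree = p.natDegree ∧
      (∫ x in a..b, |q.eval x|) < ∫ x in a..b, |p.eval x| := by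
  obtain ⟨g, rfl⟩ := hfp
  have hg : g.Monic := hf.of_mul_monic_left hp
  refine ⟨h * g, hh.mul hg, by rw [hh.natDegree_mul hg, hf.natDegree_mul hg, hdeg], ?_⟩
  obtain ⟨c, hc, hgc⟩ : ∃ c ∈ Set.Icc a b, g.eval c ≠ 0 := by
    by_contra! hzero
    exact hg.ne_zero (g.eq_zero_of_infinite_isRoot
      ((Set.Icc_infinite hab).mono fun x hx => hzero x hx))
  refine intervalIntegral.integral_lt_integral_of_continuousOn_of_le_of_exists_lt hab
    (by fun_prop) (by fun_prop) (fun x hx => ?_) ⟨c, hc, ?_⟩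
  · simp only [eval_mul, abs_mul]
    exact mul_le_mul_of_nonneg_right (hlt x (Set.Ioc_subset_Icc_self hx)).le (abs_nonneg _)
  · simp only [eval_mul, abs_mul]
    exact mul_lt_mul_of_pos_right (hlt c hc) (abs_pos.mpr hgc)

open Polynomial in
/-- A real polynomial with fewer real roots than its degree has a non-real complex root. -/
theorem exists_aeval_eq_zero_im_ne_zero_of_card_roots_ne {p : ℝ[X]} (hp : p ≠ 0)
    (hcard : Multiset.card p.roots ≠ p.natDegree) :
    ∃ z : ℂ, aeval z p = 0 ∧ z.im ≠ 0 := by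
  obtain ⟨q, hq, hqdeg, hqroots⟩ := p.exists_prod_multiset_X_sub_C_mul
  have hq0 : q ≠ 0 := by
    rintro rfl
    exact hp (by rw [← hq, mul_zero])
  obtain ⟨z, hz⟩ := IsAlgClosed.exists_aeval_eq_zero ℂ q
    (fun h => hcard (by rw [← hqdeg, natDegree_eq_zero_iff_degree_le_zero.mpr h.le, add_zero]))
  refine ⟨z, by rw [← hq, map_mul, hz, mul_zero], fun him => ?_⟩
  have hre : z = algebraMap ℝ ℂ z.re := Complex.ext (by simp) (by simp [him])
  rw [hre, aeval_algebraMap_eq_zero_iff_of_injective (algebraMap ℝ ℂ).injective] at hz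
  have hmem : z.re ∈ q.roots := (mem_roots hq0).mpr (by simpa using hz)
  simp [hqroots] at hmem

/-- A monic polynomial of degree `k ≥ 1` minimising `∫_a^b |p(x)| dx` among monic
polynomials of degree `k` has `k` real roots, counting multiplicities, all lying
in `[a,b]`. -/
theorem minimising_monic_poly_roots (a b : ℝ) (hab : a < b) (k : ℕ) (hk : 1 ≤ k)
    (p : Polynomial ℝ) (hmonic : p.Monic) (hdeg : p.natDegree = k)
    (hmin : ∀ q : Polynomial ℝ, q.Monic → q.natDegree = k →
      (∫ x in a..b, |p.eval x|) ≤ ∫ x in a..b, |q.eval x|) :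
    Multiset.card p.roots = k ∧ ∀ r ∈ p.roots, r ∈ Set.Icc a b := by
  open Polynomial in
  have not_improvable : ∀ f h : ℝ[X], f.Monic → h.Monic → f ∣ p → h.natDegree = f.natDegree →
      ¬ ∀ x ∈ Set.Icc a b, |h.eval x| < |f.eval x| := by
    intro f h hf hh hfp hd hlt
    obtain ⟨q, hq, hqd, hql⟩ :=
      exists_monic_integral_abs_lt_of_dvd hab hmonic hf hh hfp hd hlt
    exact hql.not_ge (hmin q hq (hqd.trans hdeg))
  open Polynomial in
  constructor
  · by_contra hcard
    obtain ⟨z, hz, him⟩ :=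
      exists_aeval_eq_zero_im_ne_zero_of_card_roots_ne hmonic.ne_zero (hdeg ▸ hcard)
    have hquad := p.quadratic_dvd_of_aeval_eq_zero_im_ne_zero hz him
    have hsplit : (X ^ 2 - C (2 * z.re) * X + C (‖z‖ ^ 2) : ℝ[X])
        = (X - C z.re) ^ 2 + C (z.im ^ 2) := by
      rw [Complex.sq_norm, Complex.normSq_apply]
      simp only [map_mul, map_add, map_pow, map_ofNat]
      ring
    rw [hsplit] at hquad
    have hsq : ((X - C z.re) ^ 2 : ℝ[X]).Monic := (monic_X_sub_C _).pow 2
    have hdlt : (C (z.im ^ 2) : ℝ[X]).degree < ((X - C z.re) ^ 2 : ℝ[X]).degree :=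
      degree_C_le.trans_lt (by simp [degree_pow])
    refine not_improvable _ _ (hsq.add_of_left hdlt) hsq hquad
      (natDegree_add_eq_left_of_degree_lt hdlt).symm fun x _ => ?_
    have hpos : 0 < z.im ^ 2 := by positivity
    simp only [eval_add, eval_pow, eval_sub, eval_X, eval_C]
    rw [abs_of_nonneg (by positivity), abs_of_nonneg (by positivity)]
    linarith
  · intro r hr
    have hdvd : X - C r ∣ p := dvd_iff_isRoot.mpr (isRoot_of_mem_roots hr)
    by_contra hmem
    rcases lt_or_ge r a with hra | har
    · refine not_improvable _ (X - C a) (monic_X_sub_C r) (monic_X_sub_C a) hdvd (by simp) ?_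
      rintro x ⟨hax, -⟩
      simp only [eval_sub, eval_X, eval_C]
      rw [abs_of_nonneg (by linarith), abs_of_nonneg (by linarith)]
      linarith
    · have hbr : b < r := not_le.mp fun hrb => hmem ⟨har, hrb⟩
      refine not_improvable _ (X - C b) (monic_X_sub_C r) (monic_X_sub_C b) hdvd (by simp) ?_
      rintro x ⟨-, hxb⟩
      simp only [eval_sub, eval_X, eval_C]
      rw [abs_of_nonpos (by linarith), abs_of_nonpos (by linarith)]
      linarith
end

section
/- Corrected trapezoidal rule: Let a < b be real numbers and let f be twice continuously differentiable on [a,b]. Then |∫_a^b f(x) dx − (b−a)·(f(a)+f(b))/2 − (3(b−a)^2/32)·(f'(a)−f'(b))| ≤ (b−a)^3 · ‖f''‖_∞ / 32. -/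
open MeasureTheory intervalIntegral in
/-- The integral form of the remainder of a two-point quadrature rule with quadratic Peano kernel
`(x - m) ^ 2 / 2 - k`. -/
theorem integral_quadratic_kernel_mul {a b : ℝ} (hab : a ≤ b) (m k : ℝ) {f f' f'' : ℝ → ℝ}
    (hf : ∀ x ∈ Set.Icc a b, HasDerivWithinAt f (f' x) (Set.Icc a b) x)
    (hf' : ∀ x ∈ Set.Icc a b, HasDerivWithinAt f' (f'' x) (Set.Icc a b) x)
    (hf'' : ContinuousOn f'' (Set.Icc a b)) :
    ∫ x in a..b, ((x - m) ^ 2 / 2 - k) * f'' x =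
      (∫ x in a..b, f x) +
        ((((b - m) ^ 2 / 2 - k) * f' b - (b - m) * f b) -
          (((a - m) ^ 2 / 2 - k) * f' a - (a - m) * f a)) := by
  have cf : ContinuousOn f (Set.Icc a b) := fun x hx => (hf x hx).continuousWithinAt
  have cf' : ContinuousOn f' (Set.Icc a b) := fun x hx => (hf' x hx).continuousWithinAt
  have ck : ContinuousOn (fun x => ((x - m) ^ 2 / 2 - k) * f'' x) (Set.Icc a b) := by fun_prop
  have i₁ := ck.intervalIntegrable_of_Icc (μ := volume) hab
  have i₂ := cf.intervalIntegrable_of_Icc (μ := volume) hab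
  have key := integral_eq_sub_of_hasDerivAt_of_le hab
    (f := fun x => ((x - m) ^ 2 / 2 - k) * f' x - (x - m) * f x)
    (f' := fun x => ((x - m) ^ 2 / 2 - k) * f'' x - f x) (by fun_prop)
    (fun x hx => by
      have hn := Icc_mem_nhds hx.1 hx.2
      have hx' := Set.Ioo_subset_Icc_self hx
      have h₀ := (hasDerivAt_id' x).sub_const m
      have h₁ := (((h₀.pow 2).div_const 2).sub_const k).mul ((hf' x hx').hasDerivAt hn)
      have h₂ := h₀.mul ((hf x hx').hasDerivAt hn)
      refine (h₁.sub h₂).congr_deriv ?_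
      simp
      ring)
    (i₁.sub i₂)
  rw [integral_sub i₁ i₂] at key
  linarith

open MeasureTheory intervalIntegral in
/-- A quadratic kernel times a function bounded by `M`, integrated over an interval on which the
kernel, multiplied by the sign `s`, is nonnegative. -/
theorem abs_integral_quadratic_kernel_mul_le {c d : ℝ} (hcd : c ≤ d) (m k s M : ℝ) {g : ℝ → ℝ}
    (hs : ∀ x ∈ Set.Icc c d, |(x - m) ^ 2 / 2 - k| = s * ((x - m) ^ 2 / 2 - k))
    (hg : ∀ x ∈ Set.Icc c d, |g x| ≤ M) :
    |∫ x in c..d, ((x - m) ^ 2 / 2 - k) * g x| ≤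
      M * (s * (((d - m) ^ 3 / 6 - k * d) - ((c - m) ^ 3 / 6 - k * c))) := by
  have hint : ∫ x in c..d, M * (s * ((x - m) ^ 2 / 2 - k)) =
      M * (s * (((d - m) ^ 3 / 6 - k * d) - ((c - m) ^ 3 / 6 - k * c))) := by
    rw [intervalIntegral.integral_const_mul, intervalIntegral.integral_const_mul,
      integral_eq_sub_of_hasDerivAt (f := fun x => (x - m) ^ 3 / 6 - k * x)]
    · intro x _
      have h₀ := (hasDerivAt_id' x).sub_const m
      refine (((h₀.pow 3).div_const 6).sub ((hasDerivAt_id' x).const_mul k)).congr_deriv ?_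
      simp
      ring
    · exact Continuous.intervalIntegrable (by fun_prop) _ _
  rw [← hint, ← Real.norm_eq_abs]
  refine norm_integral_le_of_norm_le hcd (.of_forall fun x hx => ?_)
    (Continuous.intervalIntegrable (by fun_prop) _ _)
  have hx' := Set.Ioc_subset_Icc_self hx
  rw [Real.norm_eq_abs, abs_mul, ← hs x hx', mul_comm]
  exact mul_le_mul_of_nonneg_right (hg x hx') (abs_nonneg _)

open MeasureTheory intervalIntegral in
/-- Corrected trapezoidal rule. -/
theorem corrected_trapezoidal_rule (a b : ℝ) (hab : a < b) (f f' f'' : ℝ → ℝ)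
    (hf : ∀ x ∈ Set.Icc a b, HasDerivWithinAt f (f' x) (Set.Icc a b) x)
    (hf' : ∀ x ∈ Set.Icc a b, HasDerivWithinAt f' (f'' x) (Set.Icc a b) x)
    (hf'' : ContinuousOn f'' (Set.Icc a b)) :
    |(∫ x in a..b, f x) - (b - a) * (f a + f b) / 2 -
        3 * (b - a) ^ 2 / 32 * (f' a - f' b)| ≤
      (b - a) ^ 3 * sSup ((fun x => |f'' x|) '' Set.Icc a b) / 32 := by
  set M := sSup ((fun x => |f'' x|) '' Set.Icc a b)
  have hM : ∀ x ∈ Set.Icc a b, |f'' x| ≤ M := fun x hx =>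
    le_csSup (isCompact_Icc.image_of_continuousOn hf''.abs).bddAbove ⟨x, hx, rfl⟩
  obtain ⟨m, r, rfl, rfl⟩ : ∃ m r, a = m - 2 * r ∧ b = m + 2 * r :=
    ⟨(a + b) / 2, (b - a) / 4, by ring, by ring⟩
  have hr : 0 < r := by linarith
  -- The kernel changes sign exactly at `m - r` and `m + r`.
  have hint : ∀ c d, m - 2 * r ≤ c → c ≤ d → d ≤ m + 2 * r →
      IntervalIntegrable (fun x => ((x - m) ^ 2 / 2 - r ^ 2 / 2) * f'' x) volume c d := by
    intro c d hc hcd hd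
    have := hf''.mono (Set.Icc_subset_Icc hc hd)
    exact ContinuousOn.intervalIntegrable_of_Icc hcd (by fun_prop)
  have h₁ := abs_integral_quadratic_kernel_mul_le (c := m - 2 * r) (d := m - r) (by linarith)
    m (r ^ 2 / 2) 1 M
    (fun x hx => by rw [one_mul, abs_of_nonneg]; nlinarith [hx.1, hx.2])
    (fun x hx => hM x ⟨hx.1, by linarith [hx.2]⟩)
  have h₂ := abs_integral_quadratic_kernel_mul_le (c := m - r) (d := m + r) (by linarith)
    m (r ^ 2 / 2) (-1) M
    (fun x hx => by rw [neg_one_mul, abs_of_nonpos]; nlinarith [hx.1, hx.2])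
    (fun x hx => hM x ⟨by linarith [hx.1], by linarith [hx.2]⟩)
  have h₃ := abs_integral_quadratic_kernel_mul_le (c := m + r) (d := m + 2 * r) (by linarith)
    m (r ^ 2 / 2) 1 M
    (fun x hx => by rw [one_mul, abs_of_nonneg]; nlinarith [hx.1, hx.2])
    (fun x hx => hM x ⟨by linarith [hx.1], hx.2⟩)
  have key := integral_quadratic_kernel_mul hab.le m (r ^ 2 / 2) hf hf' hf''
  rw [← integral_add_adjacent_intervals
      (hint (m - 2 * r) (m + r) le_rfl (by linarith) (by linarith))
      (hint (m + r) (m + 2 * r) (by linarith) (by linarith) le_rfl),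
    ← integral_add_adjacent_intervals
      (hint (m - 2 * r) (m - r) le_rfl (by linarith) (by linarith))
      (hint (m - r) (m + r) (by linarith) (by linarith) (by linarith))] at key
  rw [abs_le] at *
  constructor <;> linarith
end

section
/- Minimum L¹ norm of monic quadratics: Let a < b be real numbers. For all real numbers α and γ, ∫_a^b |(x−α)^2 − γ^2| dx ≥ (b−a)^3/16. -/
theorem integral_sub_sq_sub_sq (u v α γ : ℝ) :
    ∫ x in u..v, ((x - α) ^ 2 - γ ^ 2) =
      ((v - α) ^ 3 - (u - α) ^ 3) / 3 - γ ^ 2 * (v - u) := by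
  rw [intervalIntegral.integral_sub
    (Continuous.intervalIntegrable (by fun_prop) _ _) (by simp),
    intervalIntegral.integral_comp_sub_right (fun x => x ^ 2), integral_pow]
  simp
  ring

/-- Minimum L¹ norm of monic quadratics. -/
theorem min_L1_monic_quadratic (a b : ℝ) (hab : a < b) (α γ : ℝ) :
    (b - a) ^ 3 / 16 ≤ ∫ x in a..b, |(x - α) ^ 2 - γ ^ 2| := by
  have hint (u v : ℝ) :
      IntervalIntegrable (fun x => |(x - α) ^ 2 - γ ^ 2|) MeasureTheory.volume u v :=
    Continuous.intervalIntegrable (by fun_prop) u v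
  have hbound {u v : ℝ} (huv : u ≤ v) :
      |((v - α) ^ 3 - (u - α) ^ 3) / 3 - γ ^ 2 * (v - u)| ≤
        ∫ x in u..v, |(x - α) ^ 2 - γ ^ 2| := by
    rw [← integral_sub_sq_sub_sq]
    exact intervalIntegral.abs_integral_le_integral_abs huv
  -- The sign of the second Chebyshev polynomial of the second kind changes at the quarter points
  -- and is orthogonal to affine functions.
  have hleft := (le_abs_self _).trans (hbound (show a ≤ (3 * a + b) / 4 by linarith))
  have hmid := (neg_le_abs _).trans
    (hbound (show (3 * a + b) / 4 ≤ (a + 3 * b) / 4 by linarith))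
  have hright := (le_abs_self _).trans (hbound (show (a + 3 * b) / 4 ≤ b by linarith))
  rw [← intervalIntegral.integral_add_adjacent_intervals (hint a ((a + 3 * b) / 4)) (hint _ b),
    ← intervalIntegral.integral_add_adjacent_intervals (hint a ((3 * a + b) / 4)) (hint _ _)]
  linarith
end

section
/- Optimality of the midpoint for the shift: Let a < b be real numbers and let γ ≥ 0. For every real number α with a ≤ α − γ and α + γ ≤ b, one has ∫_a^b |(x−α)^2 − γ^2| dx ≥ ∫_a^b |(x−(a+b)/2)^2 − γ^2| dx. -/
/-- Closed form of the `L¹` norm of `(x - α) ^ 2 - γ ^ 2` when both roots lie in `[a, b]`. -/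
theorem integral_abs_sub_sq_sub_sq {a b γ α : ℝ} (hγ : 0 ≤ γ) (h1 : a ≤ α - γ)
    (h2 : α + γ ≤ b) :
    ∫ x in a..b, |(x - α) ^ 2 - γ ^ 2| =
      ((b - α) ^ 3 + (α - a) ^ 3) / 3 - γ ^ 2 * (b - a) + 8 * γ ^ 3 / 3 := by
  have hint (u v : ℝ) : IntervalIntegrable (fun x => |(x - α) ^ 2 - γ ^ 2|)
      MeasureTheory.volume u v := (by fun_prop : Continuous _).intervalIntegrable _ _
  have left : ∫ x in a..(α - γ), |(x - α) ^ 2 - γ ^ 2| =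
      ∫ x in a..(α - γ), ((x - α) ^ 2 - γ ^ 2) := by
    refine intervalIntegral.integral_congr fun x hx => abs_of_nonneg ?_
    rw [Set.uIcc_of_le h1] at hx
    nlinarith [hx.2]
  have middle : ∫ x in (α - γ)..(α + γ), |(x - α) ^ 2 - γ ^ 2| =
      ∫ x in (α - γ)..(α + γ), -((x - α) ^ 2 - γ ^ 2) := by
    refine intervalIntegral.integral_congr fun x hx => abs_of_nonpos ?_
    rw [Set.uIcc_of_le (by linarith)] at hx
    nlinarith [hx.1, hx.2]
  have right : ∫ x in (α + γ)..b, |(x - α) ^ 2 - γ ^ 2| =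
      ∫ x in (α + γ)..b, ((x - α) ^ 2 - γ ^ 2) := by
    refine intervalIntegral.integral_congr fun x hx => abs_of_nonneg ?_
    rw [Set.uIcc_of_le h2] at hx
    nlinarith [hx.1]
  rw [← intervalIntegral.integral_add_adjacent_intervals (hint a (α + γ)) (hint _ b),
    ← intervalIntegral.integral_add_adjacent_intervals (hint a (α - γ)) (hint _ _),
    left, middle, right, intervalIntegral.integral_neg]
  simp only [integral_sub_sq_sub_sq]
  ring

/-- Optimality of the midpoint for the shift. -/
theorem midpoint_shift_optimal (a b : ℝ) (hab : a < b) (γ : ℝ) (hγ : 0 ≤ γ)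
    (α : ℝ) (h1 : a ≤ α - γ) (h2 : α + γ ≤ b) :
    (∫ x in a..b, |(x - (a + b) / 2) ^ 2 - γ ^ 2|) ≤
      ∫ x in a..b, |(x - α) ^ 2 - γ ^ 2| := by
  rw [integral_abs_sub_sq_sub_sq hγ h1 h2,
    integral_abs_sub_sq_sub_sq hγ (by linarith) (by linarith)]
  nlinarith [mul_nonneg (sub_nonneg.2 hab.le) (sq_nonneg (α - (a + b) / 2))]
end

section
/- Simpson error representation: Let a < b be real numbers, set c = (a+b)/2, and let f be four times continuously differentiable on [a,b]. Then ∫_a^c f⁽⁴⁾(x)·(x−a)^3·(x − (a+2b)/3) dx + ∫_c^b f⁽⁴⁾(x)·(x−b)^3·(x − (2a+b)/3) dx = 24·∫_a^b f(x) dx − 4(b−a)·(f(a) + 4 f(c) + f(b)). -/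
open Set in
/-- Green identity for the fourth derivative: four integrations by parts at once. -/
theorem integral_fourth_deriv_mul_sub {a b : ℝ} (hab : a ≤ b)
    {f f1 f2 f3 f4 w w1 w2 w3 w4 : ℝ → ℝ}
    (hf : ∀ x ∈ Icc a b, HasDerivWithinAt f (f1 x) (Icc a b) x)
    (hf1 : ∀ x ∈ Icc a b, HasDerivWithinAt f1 (f2 x) (Icc a b) x)
    (hf2 : ∀ x ∈ Icc a b, HasDerivWithinAt f2 (f3 x) (Icc a b) x)
    (hf3 : ∀ x ∈ Icc a b, HasDerivWithinAt f3 (f4 x) (Icc a b) x)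
    (hf4 : ContinuousOn f4 (Icc a b))
    (hw : ∀ x ∈ Icc a b, HasDerivWithinAt w (w1 x) (Icc a b) x)
    (hw1 : ∀ x ∈ Icc a b, HasDerivWithinAt w1 (w2 x) (Icc a b) x)
    (hw2 : ∀ x ∈ Icc a b, HasDerivWithinAt w2 (w3 x) (Icc a b) x)
    (hw3 : ∀ x ∈ Icc a b, HasDerivWithinAt w3 (w4 x) (Icc a b) x)
    (hw4 : ContinuousOn w4 (Icc a b)) :
    (∫ x in a..b, f4 x * w x) - ∫ x in a..b, f x * w4 x =
      (f3 b * w b - f2 b * w1 b + f1 b * w2 b - f b * w3 b) -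
        (f3 a * w a - f2 a * w1 a + f1 a * w2 a - f a * w3 a) := by
  have hfc : ContinuousOn f (Icc a b) := fun x hx ↦ (hf x hx).continuousWithinAt
  have hwc : ContinuousOn w (Icc a b) := fun x hx ↦ (hw x hx).continuousWithinAt
  have hi : IntervalIntegrable (fun x ↦ f4 x * w x) MeasureTheory.volume a b :=
    (hf4.mul hwc).intervalIntegrable_of_Icc hab
  have hj : IntervalIntegrable (fun x ↦ f x * w4 x) MeasureTheory.volume a b :=
    (hfc.mul hw4).intervalIntegrable_of_Icc hab
  have hG : ∀ x ∈ Icc a b, HasDerivWithinAt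
      (fun x ↦ f3 x * w x - f2 x * w1 x + f1 x * w2 x - f x * w3 x)
      (f4 x * w x - f x * w4 x) (Icc a b) x := fun x hx ↦
    (((((hf3 x hx).mul (hw x hx)).sub ((hf2 x hx).mul (hw1 x hx))).add
      ((hf1 x hx).mul (hw2 x hx))).sub ((hf x hx).mul (hw3 x hx))).congr_deriv (by ring)
  rw [← intervalIntegral.integral_sub hi hj]
  exact intervalIntegral.integral_eq_sub_of_hasDerivAt_of_le hab
    (fun x hx ↦ (hG x hx).continuousWithinAt)
    (fun x hx ↦ (hG x (Ioo_subset_Icc_self hx)).hasDerivAt (Icc_mem_nhds hx.1 hx.2))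
    (hi.sub hj)

open Set in
/-- Green identity for the fourth derivative against the quartic weight
`(x - r) ^ 3 * (x - s)`. -/
theorem integral_fourth_deriv_mul_quartic {a b : ℝ} (hab : a ≤ b) (r s : ℝ)
    {f f1 f2 f3 f4 : ℝ → ℝ}
    (hf : ∀ x ∈ Icc a b, HasDerivWithinAt f (f1 x) (Icc a b) x)
    (hf1 : ∀ x ∈ Icc a b, HasDerivWithinAt f1 (f2 x) (Icc a b) x)
    (hf2 : ∀ x ∈ Icc a b, HasDerivWithinAt f2 (f3 x) (Icc a b) x)
    (hf3 : ∀ x ∈ Icc a b, HasDerivWithinAt f3 (f4 x) (Icc a b) x)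
    (hf4 : ContinuousOn f4 (Icc a b)) :
    (∫ x in a..b, f4 x * ((x - r) ^ 3 * (x - s))) - 24 * ∫ x in a..b, f x =
      (f3 b * ((b - r) ^ 3 * (b - s)) - f2 b * (3 * (b - r) ^ 2 * (b - s) + (b - r) ^ 3)
        + f1 b * (6 * (b - r) * (b - s) + 6 * (b - r) ^ 2)
        - f b * (18 * (b - r) + 6 * (b - s))) -
      (f3 a * ((a - r) ^ 3 * (a - s)) - f2 a * (3 * (a - r) ^ 2 * (a - s) + (a - r) ^ 3)
        + f1 a * (6 * (a - r) * (a - s) + 6 * (a - r) ^ 2)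
        - f a * (18 * (a - r) + 6 * (a - s))) := by
  have hr (x : ℝ) : HasDerivWithinAt (fun x ↦ x - r) 1 (Icc a b) x :=
    (hasDerivWithinAt_id x _).sub_const r
  have hs (x : ℝ) : HasDerivWithinAt (fun x ↦ x - s) 1 (Icc a b) x :=
    (hasDerivWithinAt_id x _).sub_const s
  have key := integral_fourth_deriv_mul_sub hab hf hf1 hf2 hf3 hf4
    (w := fun x ↦ (x - r) ^ 3 * (x - s))
    (w1 := fun x ↦ 3 * (x - r) ^ 2 * (x - s) + (x - r) ^ 3)
    (w2 := fun x ↦ 6 * (x - r) * (x - s) + 6 * (x - r) ^ 2)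
    (w3 := fun x ↦ 18 * (x - r) + 6 * (x - s)) (w4 := fun _ ↦ 24)
    (fun x _ ↦ (((hr x).pow 3).mul (hs x)).congr_deriv (by simp))
    (fun x _ ↦ (((((hr x).pow 2).const_mul 3).mul (hs x)).add ((hr x).pow 3)).congr_deriv
      (by simp; ring))
    (fun x _ ↦ ((((hr x).const_mul 6).mul (hs x)).add (((hr x).pow 2).const_mul 6)).congr_deriv
      (by simp; ring))
    (fun x _ ↦ (((hr x).const_mul 18).add ((hs x).const_mul 6)).congr_deriv (by norm_num))
    continuousOn_const
  rwa [intervalIntegral.integral_mul_const, mul_comm _ (24 : ℝ)] at key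

/-- Simpson error representation. -/
theorem simpson_error_representation (a b : ℝ) (hab : a < b) (f f1 f2 f3 f4 : ℝ → ℝ)
    (hf : ∀ x ∈ Set.Icc a b, HasDerivWithinAt f (f1 x) (Set.Icc a b) x)
    (hf1 : ∀ x ∈ Set.Icc a b, HasDerivWithinAt f1 (f2 x) (Set.Icc a b) x)
    (hf2 : ∀ x ∈ Set.Icc a b, HasDerivWithinAt f2 (f3 x) (Set.Icc a b) x)
    (hf3 : ∀ x ∈ Set.Icc a b, HasDerivWithinAt f3 (f4 x) (Set.Icc a b) x)
    (hf4 : ContinuousOn f4 (Set.Icc a b)) :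
    (∫ x in a..(a + b) / 2, f4 x * ((x - a) ^ 3 * (x - (a + 2 * b) / 3))) +
        (∫ x in ((a + b) / 2)..b, f4 x * ((x - b) ^ 3 * (x - (2 * a + b) / 3))) =
      24 * (∫ x in a..b, f x) -
        4 * (b - a) * (f a + 4 * f ((a + b) / 2) + f b) := by
  have hac : a ≤ (a + b) / 2 := by linarith
  have hcb : (a + b) / 2 ≤ b := by linarith
  have hl : Set.Icc a ((a + b) / 2) ⊆ Set.Icc a b := Set.Icc_subset_Icc_right hcb
  have hr : Set.Icc ((a + b) / 2) b ⊆ Set.Icc a b := Set.Icc_subset_Icc_left hac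
  have left := integral_fourth_deriv_mul_quartic hac a ((a + 2 * b) / 3)
    (fun x hx ↦ (hf x (hl hx)).mono hl) (fun x hx ↦ (hf1 x (hl hx)).mono hl)
    (fun x hx ↦ (hf2 x (hl hx)).mono hl) (fun x hx ↦ (hf3 x (hl hx)).mono hl) (hf4.mono hl)
  have right := integral_fourth_deriv_mul_quartic hcb b ((2 * a + b) / 3)
    (fun x hx ↦ (hf x (hr hx)).mono hr) (fun x hx ↦ (hf1 x (hr hx)).mono hr)
    (fun x hx ↦ (hf2 x (hr hx)).mono hr) (fun x hx ↦ (hf3 x (hr hx)).mono hr) (hf4.mono hr)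
  have hfc : ContinuousOn f (Set.Icc a b) := fun x hx ↦ (hf x hx).continuousWithinAt
  rw [← intervalIntegral.integral_add_adjacent_intervals
    ((hfc.mono hl).intervalIntegrable_of_Icc hac) ((hfc.mono hr).intervalIntegrable_of_Icc hcb)]
  linear_combination left + right
end
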